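/- arXiv:2206.06478 — 4 statements merged into one kernel-verified Lean document; each statement's English description precedes it below -/
import Mathlib

section
/- Let G be a finite simple graph and let t be the trivial acyclic coloring of G assigning a distinct color to every vertex. Then for every acyclic coloring c of G with fewer than |V(G)| colors, there exists a finite chain c ⊲_a c_1 ⊲_a c_2 ⊲_a ⋯ ⊲_a c_{ℓ-1} ⊲_a t of acyclic recoloring steps; equivalently, c ≺_a t, so the trivial coloring is the greatest element of the strict partial order ≺_a on acyclic colorings of G. -/
open SimpleGraph

namespace AcyclicB

variable {V : Type*}

/-- `c` is a proper vertex coloring of `G`. -/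
def Proper (G : SimpleGraph V) (c : V → ℕ) : Prop :=
  ∀ ⦃u v : V⦄, G.Adj u v → c u ≠ c v

/-- `c` is an acyclic (proper) coloring of `G`: the subgraph induced by the union of
any two color classes is a forest. -/
def IsAcyclicColoring (G : SimpleGraph V) (c : V → ℕ) : Prop :=
  Proper G c ∧ ∀ i j : ℕ, (G.induce {v | c v = i ∨ c v = j}).IsAcyclic

/-- The closed neighborhood of `v` in `G`. -/
def closedNbhd (G : SimpleGraph V) (v : V) : Set V :=
  insert v (G.neighborSet v)

/-- `c'` is obtained from the acyclic coloring `c` by an acyclic recoloring step removing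
one color `i`: every vertex of a color different from `i` keeps its color, and every vertex
of color `i` receives a color (among the colors of `c`, different from `i`) that is absent
from its closed neighborhood; the resulting coloring is again acyclic. -/
def RecolorStep (G : SimpleGraph V) (c' c : V → ℕ) : Prop :=
  IsAcyclicColoring G c ∧ IsAcyclicColoring G c' ∧
  ∃ i ∈ Set.range c,
    (∀ v, c v ≠ i → c' v = c v) ∧
    (∀ v, c v = i → c' v ∈ Set.range c ∧ c' v ≠ i ∧
      ∀ u ∈ closedNbhd G v, c u ≠ c' v)

/-- The strict partial order `≺ₐ` on acyclic colorings: the transitive closure of the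
acyclic recoloring step relation. -/
def StrictOrder (G : SimpleGraph V) : (V → ℕ) → (V → ℕ) → Prop :=
  Relation.TransGen (RecolorStep G)

/-- `c` is a minimal element of `≺ₐ`: an acyclic coloring admitting no acyclic recoloring
step. -/
def IsMinimal (G : SimpleGraph V) (c : V → ℕ) : Prop :=
  IsAcyclicColoring G c ∧ ∀ c', ¬ RecolorStep G c' c

/-- The number of colors used by `c`. -/
def ncolors [Fintype V] (c : V → ℕ) : ℕ :=
  (Finset.univ.image c).card

/-- The acyclic b-chromatic number of `G`: the maximum number of colors used by a minimal
element of `≺ₐ`. -/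
noncomputable def Ab [Fintype V] (G : SimpleGraph V) : ℕ :=
  sSup { k | ∃ c : V → ℕ, IsMinimal G c ∧ ncolors c = k }

/-- The acyclic chromatic number of `G`: the minimum number of colors in an acyclic
proper coloring. -/
noncomputable def Achrom [Fintype V] (G : SimpleGraph V) : ℕ :=
  sInf { k | ∃ c : V → ℕ, IsAcyclicColoring G c ∧ ncolors c = k }

/-- The join of two graphs: disjoint copies of `G` and `H` together with all edges
between them. -/
def join {α β : Type*} (G : SimpleGraph α) (H : SimpleGraph β) : SimpleGraph (α ⊕ β) where
  Adj x y :=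
    match x, y with
    | Sum.inl a, Sum.inl a' => G.Adj a a'
    | Sum.inr b, Sum.inr b' => H.Adj b b'
    | Sum.inl _, Sum.inr _ => True
    | Sum.inr _, Sum.inl _ => True
  symm := by
    refine ⟨?_⟩
    rintro (a | b) (a' | b') h
    · exact G.adj_symm h
    · trivial
    · trivial
    · exact H.adj_symm h
  loopless := by
    refine ⟨?_⟩
    rintro (a | b) h
    · exact G.loopless.irrefl a h
    · exact H.loopless.irrefl b h

end AcyclicB

namespace AcyclicB

/-- Splitting off a vertex `v` into a color class of its own keeps a coloring acyclic. -/
theorem IsAcyclicColoring.update [DecidableEq V] {G : SimpleGraph V} {c : V → ℕ}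
    (hc : IsAcyclicColoring G c) (v : V) {a : ℕ} (ha : a ∉ Set.range c) :
    IsAcyclicColoring G (Function.update c v a) := by
  have hne : ∀ w, c w ≠ a := fun w h => ha ⟨w, h⟩
  refine ⟨fun u w h => ?_, fun i j => ?_⟩
  · have h1 := hc.1 h
    have h2 := h.ne
    simp only [Function.update_apply]
    grind
  · have hsub : {w | Function.update c v a w = i ∨ Function.update c v a w = j} ⊆
        {w | c w = (if i = a then c v else i) ∨ c w = (if j = a then c v else j)} := by
      intro w hw
      simp only [Function.update_apply, Set.mem_ofPred_eq] at hw ⊢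
      grind
    exact (hc.2 _ _).comap (induceHomOfLE G hsub).toHom (induceHomOfLE G hsub).injective

/-- Merging a singleton color class into another class is an acyclic recoloring step. -/
theorem IsAcyclicColoring.recolorStep_update [DecidableEq V] {G : SimpleGraph V} {c : V → ℕ}
    (hc : IsAcyclicColoring G c) {v r : V} {a : ℕ} (ha : a ∉ Set.range c) (hr : r ≠ v)
    (hcr : c r = c v) : RecolorStep G c (Function.update c v a) := by
  have hne : ∀ w, c w ≠ a := fun w h => ha ⟨w, h⟩
  refine ⟨hc.update v ha, hc, a, ⟨v, by simp⟩, fun w hw => ?_, fun w hw => ?_⟩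
  · have hwv : w ≠ v := by rintro rfl; simp at hw
    simp [hwv]
  · obtain rfl : w = v := by
      by_contra h
      exact hne w (by simpa [h] using hw)
    refine ⟨⟨r, by simp [hr, hcr]⟩, hne w, ?_⟩
    rintro u (rfl | hu)
    · simpa using (hne u).symm
    · have hu : G.Adj w u := hu
      simpa [hu.ne'] using (hc.1 hu).symm

/-- An acyclic coloring whose colors are represented by vertices on which it agrees with the
trivial coloring `t` is reached from `t` by finitely many acyclic recoloring steps. -/
theorem IsAcyclicColoring.reflTransGen_trivial [Fintype V] {G : SimpleGraph V} {t : V → ℕ}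
    (ht : Function.Injective t) {c : V → ℕ} (hc : IsAcyclicColoring G c)
    (hsub : Set.range c ⊆ Set.range t) (hagree : ∀ v : V, t v ∈ Set.range c → c v = t v) :
    Relation.ReflTransGen (RecolorStep G) c t := by
  classical
  induction hn : (Finset.univ.filter fun v => c v ≠ t v).card using Nat.strong_induction_on
    generalizing c with
  | _ n ih =>
    by_cases hct : c = t
    · rw [hct]
    obtain ⟨v, hv⟩ := Function.ne_iff.mp hct
    have hfresh : t v ∉ Set.range c := fun h => hv (hagree v h)
    obtain ⟨r, hr⟩ := hsub ⟨v, rfl⟩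
    have hcr : c r = c v := (hagree r ⟨v, hr.symm⟩).trans hr
    have hrv : r ≠ v := by rintro rfl; exact hv hr.symm
    refine .head (hc.recolorStep_update hfresh hrv hcr) (ih _ ?_ (hc.update v hfresh) ?_ ?_ rfl)
    · rw [← hn]
      refine Finset.card_lt_card
        ((Finset.ssubset_iff_of_subset ?_).mpr ⟨v, by simpa using hv, by simp⟩)
      intro w hw
      simp only [Function.update_apply, Finset.mem_filter, Finset.mem_univ, true_and] at hw ⊢
      grind
    · rintro _ ⟨w, rfl⟩
      rcases eq_or_ne w v with rfl | hw
      · simp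
      · simpa [hw] using hsub ⟨w, rfl⟩
    · rintro w ⟨x, hx⟩
      rcases eq_or_ne w v with rfl | hw
      · simp
      · have hxv : x ≠ v := by
          rintro rfl
          exact hw (ht (by simpa using hx.symm))
        simpa [hw] using hagree w ⟨x, by simpa [hxv] using hx⟩

/-- The trivial coloring `t` (assigning a distinct color to every vertex) is the greatest
element of `≺ₐ`: every acyclic coloring `c` with fewer than `|V(G)|` colors (whose colors
are, as in the paper's normalization, the "first" colors of `t`: each color of `c` is a
color of `t`, agreeing with `c` on a system of representatives) is connected to `t` by a
chain of acyclic recoloring steps, i.e. `c ≺ₐ t`. -/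
theorem lt_trivial_coloring {V : Type*} [Fintype V] (G : SimpleGraph V)
    (t : V → ℕ) (ht : Function.Injective t)
    (c : V → ℕ) (hc : IsAcyclicColoring G c)
    (hcard : ncolors c < Fintype.card V)
    (hsub : Set.range c ⊆ Set.range t)
    (hagree : ∀ v : V, t v ∈ Set.range c → c v = t v) :
    Relation.TransGen (RecolorStep G) c t := by
  rcases Relation.reflTransGen_iff_eq_or_transGen.mp (hc.reflTransGen_trivial ht hsub hagree)
    with rfl | h
  · simp [ncolors, Finset.card_image_of_injective _ ht] at hcard
  · exact h

end AcyclicB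
end

section
/- For every integer ℓ ≥ 5, the path P_ℓ on ℓ vertices satisfies A_b(P_ℓ) = 3. -/
open SimpleGraph

namespace AcyclicB

lemma isAcyclic_pathGraph (n : ℕ) : (pathGraph n).IsAcyclic := by
  rw [isAcyclic_iff_free_cycleGraph]
  rintro k hk ⟨f⟩
  obtain ⟨m, rfl⟩ := Nat.exists_eq_add_of_le' hk
  obtain ⟨i, hi⟩ := Finite.exists_max f
  have below (j : Fin (m + 3)) (h : (cycleGraph (m + 3)).Adj i j) : (f j).val + 1 = (f i).val := by
    have := pathGraph_adj.mp (f.toHom.map_adj h)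
    have := Fin.le_def.mp (hi j)
    simp only [Copy.toHom_apply] at *
    omega
  have h₁ := below (i + 1) (by simp [cycleGraph_adj])
  have h₂ := below (i - 1) (by simp [cycleGraph_adj])
  have h : i + 1 = i - 1 := f.injective (Fin.ext (Nat.succ_injective (h₁.trans h₂.symm)))
  have h2 : (1 + 1 : Fin (m + 3)) = 0 := by
    rwa [eq_sub_iff_add_eq, add_assoc, add_eq_left] at h
  have : 2 % (m + 3) = 0 := by simpa [Fin.ext_iff, Fin.val_add] using h2
  rw [Nat.mod_eq_of_lt (by omega)] at this
  contradiction

lemma isAcyclicColoring_iff_proper {V : Type*} {G : SimpleGraph V} (hG : G.IsAcyclic)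
    {c : V → ℕ} : IsAcyclicColoring G c ↔ Proper G c :=
  ⟨And.left, fun h ↦ ⟨h, fun _ _ ↦ hG.induce _⟩⟩

/-- In a forest, a minimal coloring has a b-vertex in every color class, hence uses no more colors
than a closed neighborhood has vertices. -/
lemma IsMinimal.ncolors_le {V : Type*} [Fintype V] [Nonempty V] {G : SimpleGraph V}
    (hG : G.IsAcyclic) {k : ℕ} (hk : ∀ v, (closedNbhd G v).ncard ≤ k) {c : V → ℕ}
    (hc : IsMinimal G c) : ncolors c ≤ k := by
  by_contra! hlt
  have free (v : V) : ∃ j ∈ Set.range c, ∀ u ∈ closedNbhd G v, c u ≠ j := by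
    have hcard : (c '' closedNbhd G v).ncard < (Set.range c).ncard := by
      have : (Set.range c).ncard = ncolors c := by
        rw [ncolors, ← Set.ncard_coe_finset, Finset.coe_image, Finset.coe_univ, Set.image_univ]
      have := Set.ncard_image_le (f := c) (Set.toFinite (closedNbhd G v))
      have := hk v
      omega
    obtain ⟨j, hj, hj'⟩ := Set.exists_mem_notMem_of_ncard_lt_ncard hcard
    exact ⟨j, hj, fun u hu h ↦ hj' ⟨u, hu, h⟩⟩
  choose d hd hdc using free
  obtain ⟨v₀⟩ := ‹Nonempty V›
  have hp := hc.1.1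
  refine hc.2 (fun v ↦ if c v = c v₀ then d v else c v)
    ⟨hc.1, (isAcyclicColoring_iff_proper hG).mpr fun u v huv ↦ ?_, c v₀, ⟨v₀, rfl⟩,
      fun v hv ↦ if_neg hv, fun v hv ↦ ?_⟩
  · have := hp huv
    have := hdc u v (Or.inr huv)
    have := hdc v u (Or.inr huv.symm)
    split_ifs <;> grind
  · simp only [if_pos hv]
    exact ⟨hd v, fun h ↦ hdc v v (Or.inl rfl) (hv.trans h.symm), hdc v⟩

lemma ncard_closedNbhd_pathGraph_le {n : ℕ} (v : Fin n) :
    (closedNbhd (pathGraph n) v).ncard ≤ 3 := by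
  have hsub : Fin.val '' closedNbhd (pathGraph n) v ⊆ {v.val - 1, v.val, v.val + 1} := by
    rintro _ ⟨u, rfl | hu, rfl⟩
    · simp
    · have := pathGraph_adj.mp hu
      simp only [Set.mem_insert_iff, Set.mem_singleton_iff]
      omega
  rw [← Set.ncard_image_of_injective _ Fin.val_injective]
  refine (Set.ncard_le_ncard hsub).trans ?_
  exact (Set.ncard_insert_le _ _).trans (Nat.succ_le_succ ((Set.ncard_insert_le _ _).trans (by rw [Set.ncard_singleton])))

lemma isMinimal_pathGraph_mod_three {n : ℕ} (hn : 5 ≤ n) :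
    IsMinimal (pathGraph n) (fun v ↦ v.val % 3) := by
  refine ⟨(isAcyclicColoring_iff_proper (isAcyclic_pathGraph n)).mpr fun u v huv ↦ ?_, ?_⟩
  · have := pathGraph_adj.mp huv
    omega
  · rintro c' ⟨-, -, _, ⟨w, rfl⟩, -, h⟩
    obtain ⟨b, hb, hb₁, hb₃⟩ : ∃ b, b % 3 = w.val % 3 ∧ 1 ≤ b ∧ b ≤ 3 :=
      ⟨(w.val + 2) % 3 + 1, by omega, by omega, by omega⟩
    obtain ⟨⟨x, hx⟩, hne, hnb⟩ := h ⟨b, by omega⟩ hb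
    have h₁ := hnb ⟨b - 1, by omega⟩ (Or.inr (pathGraph_adj.mpr (Or.inr (by simp; omega))))
    have h₂ := hnb ⟨b + 1, by omega⟩ (Or.inr (pathGraph_adj.mpr (Or.inl rfl)))
    dsimp only at hx hne h₁ h₂
    omega

lemma ncolors_pathGraph_mod_three {n : ℕ} (hn : 3 ≤ n) :
    ncolors (fun v : Fin n ↦ v.val % 3) = 3 := by
  have : Finset.univ.image (fun v : Fin n ↦ v.val % 3) = Finset.range 3 := by
    ext j
    simp only [Finset.mem_image, Finset.mem_univ, true_and, Finset.mem_range]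
    refine ⟨?_, fun hj ↦ ⟨⟨j, by omega⟩, Nat.mod_eq_of_lt hj⟩⟩
    rintro ⟨v, rfl⟩
    exact Nat.mod_lt _ (by norm_num)
  rw [ncolors, this, Finset.card_range]

/-- For every `ℓ ≥ 5`, the path on `ℓ` vertices satisfies `A_b(P_ℓ) = 3`. -/
theorem ab_pathGraph (ℓ : ℕ) (hℓ : 5 ≤ ℓ) :
    Ab (SimpleGraph.pathGraph ℓ) = 3 := by
  have : Nonempty (Fin ℓ) := ⟨⟨0, by omega⟩⟩
  refine IsGreatest.csSup_eq
    ⟨⟨_, isMinimal_pathGraph_mod_three hℓ, ncolors_pathGraph_mod_three (by omega)⟩, ?_⟩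
  rintro _ ⟨c, hc, rfl⟩
  exact hc.ncolors_le (isAcyclic_pathGraph ℓ) ncard_closedNbhd_pathGraph_le

end AcyclicB
end

section
/- For all positive integers n and m, the complete split graph K_n ∨ K̄_m satisfies A_b(K_n ∨ K̄_m) = n + 1. -/
open SimpleGraph

namespace AcyclicB

theorem Proper.isAcyclicColoring {V : Type*} {G : SimpleGraph V} {c : V → ℕ} (hc : Proper G c)
    (hG : ∀ ⦃u v⦄, G.Adj u v → G.IsUniversal u ∨ G.IsUniversal v) :
    IsAcyclicColoring G c := by
  refine ⟨hc, fun i j => ?_⟩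
  by_cases h : ∃ x : {v | c v = i ∨ c v = j}, G.IsUniversal x.1
  · obtain ⟨⟨x, hx⟩, hux⟩ := h
    refine (isAcyclic_starGraph (⟨x, hx⟩ : {v | c v = i ∨ c v = j})).anti ?_
    rintro ⟨u, hu⟩ ⟨v, hv⟩ huv
    have huv : G.Adj u v := huv
    rw [starGraph_adj]
    refine ⟨fun h => huv.ne (congrArg Subtype.val h), ?_⟩
    by_contra! hne
    have hxu : c x ≠ c u := hc (hux fun h => hne.1 (Subtype.ext h.symm))
    have hxv : c x ≠ c v := hc (hux fun h => hne.2 (Subtype.ext h.symm))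
    have huv' := hc huv
    simp only [Set.mem_ofPred_eq] at hu hv hx
    omega
  · convert isAcyclic_bot
    rw [eq_bot_iff]
    rintro u v huv
    exact h ((hG huv).elim (⟨u, ·⟩) (⟨v, ·⟩))

/-- The complete split graph `Kₙ ∨ K̄ₘ`. -/
abbrev completeSplit (n m : ℕ) : SimpleGraph (Fin n ⊕ Fin m) :=
  join (completeGraph (Fin n)) (completeGraph (Fin m))ᶜ

variable {n m : ℕ} {c : Fin n ⊕ Fin m → ℕ}

theorem completeSplit_isUniversal_inl (a : Fin n) :
    (completeSplit n m).IsUniversal (Sum.inl a) := by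
  rintro (a' | b) h
  · exact fun h' => h (congrArg Sum.inl h')
  · trivial

theorem completeSplit_not_adj_inr (b b' : Fin m) :
    ¬ (completeSplit n m).Adj (Sum.inr b) (Sum.inr b') :=
  fun h => h.2 h.1

theorem completeSplit_isAcyclicColoring (hc : Proper (completeSplit n m) c) :
    IsAcyclicColoring (completeSplit n m) c := by
  refine hc.isAcyclicColoring ?_
  rintro (a | b) (a' | b') h
  · exact .inl (completeSplit_isUniversal_inl a)
  · exact .inl (completeSplit_isUniversal_inl a)
  · exact .inr (completeSplit_isUniversal_inl a')
  · exact absurd h (completeSplit_not_adj_inr b b')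

theorem Proper.completeSplit_ne (hc : Proper (completeSplit n m) c) {a : Fin n}
    {v : Fin n ⊕ Fin m} (h : Sum.inl a ≠ v) : c (Sum.inl a) ≠ c v :=
  hc (completeSplit_isUniversal_inl a h)

theorem IsMinimal.completeSplit_inr_eq (hc : IsMinimal (completeSplit n m) c) (b b' : Fin m) :
    c (Sum.inr b) = c (Sum.inr b') := by
  by_contra hne
  have hp := hc.1.1
  have hl : ∀ a b, c (Sum.inl a) ≠ c (Sum.inr b) := fun a b => hp.completeSplit_ne Sum.inl_ne_inr
  refine hc.2 (fun v => if c v = c (Sum.inr b) then c (Sum.inr b') else c v)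
    ⟨hc.1, completeSplit_isAcyclicColoring ?_, c (Sum.inr b), ⟨_, rfl⟩, ?_, ?_⟩
  · rintro (x | x) (y | y) h
    · simpa [hl] using hp h
    · have := hl x b'
      have := hp h
      simp only [hl, if_false]
      split_ifs <;> assumption
    · have := (hl y b').symm
      have := hp h
      simp only [hl, if_false]
      split_ifs <;> assumption
    · exact absurd h (completeSplit_not_adj_inr x y)
  · intro v hv
    simp [hv]
  · rintro (a | x) hv
    · exact absurd hv (hl a b)
    · simp only [hv, if_true]
      refine ⟨⟨_, rfl⟩, Ne.symm hne, ?_⟩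
      rintro u (rfl | hu)
      · rwa [hv]
      · rcases u with a | y
        · exact hl a b'
        · exact absurd hu (completeSplit_not_adj_inr (n := n) x y)

theorem Proper.ncolors_completeSplit (hc : Proper (completeSplit n m) c) (b : Fin m)
    (hb : ∀ b', c (Sum.inr b') = c (Sum.inr b)) : ncolors c = n + 1 := by
  have himage : Finset.univ.image c =
      insert (c (Sum.inr b)) (Finset.univ.image (c ∘ Sum.inl)) := by
    ext k
    simp [hb, or_comm, eq_comm, show Nonempty (Fin m) from ⟨b⟩]
  have hinj : Function.Injective (c ∘ Sum.inl) := fun a a' h => by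
    by_contra hne
    exact hc.completeSplit_ne (Sum.inl_injective.ne hne) h
  rw [ncolors, himage, Finset.card_insert_of_notMem, Finset.card_image_of_injective _ hinj,
    Finset.card_univ, Fintype.card_fin]
  simpa using fun a => hc.completeSplit_ne (Sum.inl_ne_inr (a := a) (b := b))

theorem Proper.completeSplit_isMinimal (hc : Proper (completeSplit n m) c)
    (hinr : ∀ b b', c (Sum.inr b) = c (Sum.inr b')) : IsMinimal (completeSplit n m) c := by
  refine ⟨completeSplit_isAcyclicColoring hc, ?_⟩
  rintro c' ⟨-, -, -, ⟨v, rfl⟩, -, h⟩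
  obtain ⟨⟨w, hw⟩, -, hv⟩ := h v rfl
  have hself := hv v (Set.mem_insert _ _)
  rw [← hw] at hself hv
  have hwv : w ≠ v := fun h => hself (congrArg c h.symm)
  have hadj : (completeSplit n m).Adj v w := by
    rcases v with a | b
    · exact completeSplit_isUniversal_inl a hwv.symm
    · rcases w with a | b'
      · exact (completeSplit_isUniversal_inl a hwv).symm
      · exact absurd (hinr b b') hself
  exact hv w (Set.mem_insert_of_mem _ hadj) rfl

/-- For all positive integers `n` and `m`, the complete split graph `Kₙ ∨ K̄ₘ` satisfies
`A_b(Kₙ ∨ K̄ₘ) = n + 1`. -/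
theorem ab_completeSplit (n m : ℕ) (hn : 1 ≤ n) (hm : 1 ≤ m) :
    Ab (join (completeGraph (Fin n)) (completeGraph (Fin m))ᶜ) = n + 1 := by
  have hset : {k | ∃ c, IsMinimal (completeSplit n m) c ∧ ncolors c = k} = {n + 1} := by
    ext k
    constructor
    · rintro ⟨c, hc, rfl⟩
      exact hc.1.1.ncolors_completeSplit ⟨0, hm⟩ fun b => hc.completeSplit_inr_eq b _
    · rintro rfl
      have hp : Proper (completeSplit n m) (Sum.elim Fin.val fun _ => n) := by
        rintro (a | b) (a' | b') h
        · exact Fin.val_injective.ne h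
        · exact a.isLt.ne
        · exact a'.isLt.ne'
        · exact absurd h (completeSplit_not_adj_inr b b')
      exact ⟨_, hp.completeSplit_isMinimal fun _ _ => rfl,
        hp.ncolors_completeSplit ⟨0, hm⟩ fun _ => rfl⟩
  exact (congrArg sSup hset).trans (csSup_singleton _)

end AcyclicB
end

section
/- For all integers k, ℓ ≥ 5, the joins of paths and cycles satisfy A_b(P_k ∨ P_ℓ) = A_b(P_k ∨ C_ℓ) = A_b(C_k ∨ C_ℓ) = 3 + max{k, ℓ}. -/
open SimpleGraph

namespace AcyclicB

open SimpleGraph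

/-! ### Acyclicity and four-cycles -/

/-- A graph is acyclic if its vertices can be ranked so that each vertex has at most one neighbor
of no larger rank. -/
lemma isAcyclic_of_rank {W : Type*} {Γ : SimpleGraph W} (f : W → ℕ)
    (h : ∀ ⦃v a b⦄, Γ.Adj v a → Γ.Adj v b → f a ≤ f v → f b ≤ f v → a = b) : Γ.IsAcyclic := by
  classical
  intro u p hp
  obtain ⟨v, hv, hmax⟩ := Finset.exists_max_image p.support.toFinset f ⟨u, by simp⟩
  simp only [List.mem_toFinset] at hv hmax
  have hcard := hp.ncard_neighborSet_toSubgraph_eq_two hv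
  obtain ⟨a, b, hab, hs⟩ := Set.ncard_eq_two.mp hcard
  have key : ∀ x ∈ p.toSubgraph.neighborSet v, Γ.Adj v x ∧ f x ≤ f v := fun x hx =>
    ⟨hx.adj_sub, hmax x ((Walk.mem_verts_toSubgraph p).mp hx.snd_mem)⟩
  obtain ⟨ha, ha'⟩ := key a (by simp [hs])
  obtain ⟨hb, hb'⟩ := key b (by simp [hs])
  exact hab (h ha hb ha' hb')

lemma eq_of_four_cycle_of_isAcyclic {W : Type*} {Γ : SimpleGraph W} (h : Γ.IsAcyclic) {a b a' b' : W}
    (hab : Γ.Adj a b) (hba' : Γ.Adj b a') (hab' : Γ.Adj a b') (hb'a' : Γ.Adj b' a')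
    (ha : a ≠ a') : b = b' := by
  have hp : (Walk.cons hab (Walk.cons hba' Walk.nil)).IsPath := by
    simp [hab.ne, hba'.ne, ha]
  have hq : (Walk.cons hab' (Walk.cons hb'a' Walk.nil)).IsPath := by
    simp [hab'.ne, hb'a'.ne, ha]
  have := congrArg (fun p => p.1.snd) ((h.subsingleton_path _ _).elim ⟨_, hp⟩ ⟨_, hq⟩)
  simpa using this

/-! ### Colorings and graph isomorphisms -/

section Iso

variable {α β : Type*} {G : SimpleGraph α} {H : SimpleGraph β}

lemma IsAcyclicColoring.comp_iso {c : β → ℕ} (hc : IsAcyclicColoring H c) (e : G ≃g H) :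
    IsAcyclicColoring G (c ∘ e) := by
  refine ⟨fun u v huv => hc.1 (e.map_adj_iff.mpr huv), fun i j => ?_⟩
  refine (hc.2 i j).comap ⟨fun v => ⟨e v.1, v.2⟩, fun {u v} huv => ?_⟩ fun u v huv => ?_
  · exact e.map_adj_iff.mpr huv
  · exact Subtype.ext (e.injective (congrArg Subtype.val huv))

lemma RecolorStep.comp_iso {c c' : β → ℕ} (h : RecolorStep H c' c) (e : G ≃g H) :
    RecolorStep G (c' ∘ e) (c ∘ e) := by
  obtain ⟨hc, hc', i, hi, hkeep, hmove⟩ := h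
  have hrange : Set.range (c ∘ e) = Set.range c := e.surjective.range_comp c
  refine ⟨hc.comp_iso e, hc'.comp_iso e, i, hrange ▸ hi, fun v => hkeep (e v), fun v hv => ?_⟩
  obtain ⟨h1, h2, h3⟩ := hmove (e v) hv
  refine ⟨hrange ▸ h1, h2, fun u hu => h3 (e u) ?_⟩
  rcases hu with rfl | hu
  · exact Or.inl rfl
  · exact Or.inr (e.map_adj_iff.mpr hu)

lemma IsMinimal.comp_iso {c : β → ℕ} (hc : IsMinimal H c) (e : G ≃g H) :
    IsMinimal G (c ∘ e) := by
  refine ⟨hc.1.comp_iso e, fun c' hstep => hc.2 (c' ∘ e.symm) ?_⟩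
  have h := hstep.comp_iso e.symm
  have hcomp : (c ∘ e) ∘ e.symm = c := by
    ext v
    simp
  rwa [hcomp] at h

lemma ncolors_comp_iso [Fintype α] [Fintype β] (c : β → ℕ) (e : G ≃g H) :
    ncolors (c ∘ e) = ncolors c := by
  have : Finset.univ.image (c ∘ e) = Finset.univ.image c := by
    ext i
    simp [e.surjective.exists]
  rw [ncolors, ncolors, this]

/-- The join is commutative. -/
def joinComm (G : SimpleGraph α) (H : SimpleGraph β) : join G H ≃g join H G where
  toEquiv := Equiv.sumComm α β
  map_rel_iff' := by rintro (a | b) (a' | b') <;> rfl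

end Iso

/-! ### Acyclic colorings of joins -/

section Join

variable {α β : Type*} {G : SimpleGraph α} {H : SimpleGraph β} {c : α ⊕ β → ℕ}

lemma IsAcyclicColoring.ne_of_join (hc : IsAcyclicColoring (join G H) c) (a : α) (b : β) :
    c (Sum.inl a) ≠ c (Sum.inr b) :=
  hc.1 (u := Sum.inl a) (v := Sum.inr b) trivial

/-- An acyclic coloring of a join is injective on one of the two sides. -/
lemma IsAcyclicColoring.injective_or_injective (hc : IsAcyclicColoring (join G H) c) :
    Function.Injective (c ∘ Sum.inl) ∨ Function.Injective (c ∘ Sum.inr) := by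
  by_contra! hcon
  simp only [Function.Injective, not_forall, Function.comp_apply] at hcon
  obtain ⟨⟨a, a', ha, hne⟩, b, b', hb, hne'⟩ := hcon
  let S : Set (α ⊕ β) := {v | c v = c (Sum.inl a) ∨ c v = c (Sum.inr b)}
  have h := eq_of_four_cycle_of_isAcyclic (hc.2 (c (Sum.inl a)) (c (Sum.inr b)))
    (a := (⟨Sum.inl a, Or.inl rfl⟩ : S)) (b := (⟨Sum.inr b, Or.inr rfl⟩ : S))
    (a' := (⟨Sum.inl a', Or.inl ha.symm⟩ : S)) (b' := (⟨Sum.inr b', Or.inr hb.symm⟩ : S))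
    trivial trivial trivial trivial (by simpa using hne)
  exact hne' (by simpa using h)

lemma isAcyclicColoring_join (hG : IsAcyclicColoring G (c ∘ Sum.inl))
    (hH : Function.Injective (c ∘ Sum.inr)) (hd : ∀ a b, c (Sum.inl a) ≠ c (Sum.inr b)) :
    IsAcyclicColoring (join G H) c := by
  have hproper : Proper (join G H) c := by
    rintro (a | b) (a' | b') h
    · exact hG.1 h
    · exact hd a b'
    · exact (hd a' b).symm
    · exact fun hbb => H.ne_of_adj h (hH hbb)
  refine ⟨hproper, fun i j => ?_⟩
  by_cases hex : ∃ b, c (Sum.inr b) = i ∨ c (Sum.inr b) = j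
  · obtain ⟨b₀, hb₀⟩ := hex
    have two : ∀ {x y z : α ⊕ β}, (c x = i ∨ c x = j) → (c y = i ∨ c y = j) →
        (c z = i ∨ c z = j) → c x ≠ c y → c x ≠ c z → c y = c z := by
      intros; omega
    refine isAcyclic_of_rank (fun v => Sum.elim (fun _ => 1) (fun _ => 0) v.1) ?_
    rintro ⟨v, hv⟩ ⟨a, ha⟩ ⟨b, hb⟩ hva hvb hfa hfb
    have hab := two hv ha hb (hproper hva) (hproper hvb)
    refine Subtype.ext ?_
    rcases v with v | v
    · have hh := two hv ha hb₀ (hproper hva) (hd v b₀)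
      rcases a with a | a
      · exact absurd hh (hd a b₀)
      rcases b with b | b
      · exact absurd hab.symm (hd b a)
      · exact congrArg Sum.inr (hH hab)
    · rcases a with a | a
      · simp at hfa
      rcases b with b | b
      · simp at hfb
      · exact congrArg Sum.inr (hH hab)
  · have hleft : ∀ v : {v | c v = i ∨ c v = j}, ∃ a, v.1 = Sum.inl a := by
      rintro ⟨a | b, hv⟩
      · exact ⟨a, rfl⟩
      · exact absurd ⟨b, hv⟩ hex
    choose g hg using hleft
    have hmem : ∀ v, g v ∈ {v | (c ∘ Sum.inl) v = i ∨ (c ∘ Sum.inl) v = j} := fun v => by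
      have := v.2
      rwa [Set.mem_ofPred_eq, hg v] at this
    refine (hG.2 i j).comap ⟨fun v => ⟨g v, hmem v⟩, fun {u v} huv => ?_⟩ fun u v huv => ?_
    · have huv' : (join G H).Adj u.1 v.1 := huv
      rw [hg u, hg v] at huv'
      exact huv'
    · have : g u = g v := congrArg Subtype.val huv
      exact Subtype.ext (by rw [hg u, hg v, this])

end Join

/-! ### Minimal colorings of joins with graphs of maximum degree two -/

section Minimal

variable {α β : Type*} [Fintype α] {G : SimpleGraph α} {H : SimpleGraph β}

/-- If `G` has maximum degree two and each of its proper colorings with at least three colors is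
acyclic, then a minimal coloring of `G ∨ H` that is injective on `H` uses at most three colors
on `G`. -/
lemma IsMinimal.ncolors_inl_le {c : α ⊕ β → ℕ} (hc : IsMinimal (join G H) c)
    (hinj : Function.Injective (c ∘ Sum.inr))
    (hdeg : ∀ v x y z, G.Adj v x → G.Adj v y → G.Adj v z → x = y ∨ x = z ∨ y = z)
    (hacyc : ∀ d : α → ℕ, Proper G d → 3 ≤ ncolors d → IsAcyclicColoring G d) :
    ncolors (c ∘ Sum.inl) ≤ 3 := by
  classical
  by_contra! hcard
  have hd := hc.1.ne_of_join
  set d : α → ℕ := c ∘ Sum.inl with hd_def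
  have hfree : ∀ v, ∃ t ∈ Finset.univ.image d, t ≠ d v ∧ ∀ u, G.Adj v u → d u ≠ t := by
    intro v
    by_contra! hcon
    have hlt : 2 < ((Finset.univ.image d).erase (d v)).card := by
      have := Finset.pred_card_le_card_erase (s := Finset.univ.image d) (a := d v)
      unfold ncolors at hcard
      omega
    obtain ⟨p, hp, q, hq, r, hr, hpq, hpr, hqr⟩ := Finset.two_lt_card.mp hlt
    obtain ⟨x, hx, rfl⟩ := hcon p (Finset.mem_of_mem_erase hp) (Finset.ne_of_mem_erase hp)
    obtain ⟨y, hy, rfl⟩ := hcon q (Finset.mem_of_mem_erase hq) (Finset.ne_of_mem_erase hq)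
    obtain ⟨z, hz, rfl⟩ := hcon r (Finset.mem_of_mem_erase hr) (Finset.ne_of_mem_erase hr)
    rcases hdeg v x y z hx hy hz with rfl | rfl | rfl <;> contradiction
  choose t ht htv htu using hfree
  have htrange : ∀ v, ∃ w, d w = t v := fun v => by simpa using ht v
  obtain ⟨i, hi⟩ : (Finset.univ.image d).Nonempty :=
    Finset.card_pos.mp (by unfold ncolors at hcard; omega)
  obtain ⟨w, -, hw⟩ := Finset.mem_image.mp hi
  let d' : α → ℕ := fun v => if d v = i then t v else d v
  have hpos : ∀ v, d v = i → d' v = t v := fun v hv => if_pos hv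
  have hneg : ∀ v, d v ≠ i → d' v = d v := fun v hv => if_neg hv
  have hproper : Proper G d' := by
    intro u v huv
    have hne : d u ≠ d v := hc.1.1 (u := Sum.inl u) (v := Sum.inl v) huv
    by_cases hu : d u = i
    · rw [hpos u hu, hneg v (fun hv => hne (hu.trans hv.symm))]
      exact (htu u v huv).symm
    · rw [hneg u hu]
      by_cases hv : d v = i
      · rw [hpos v hv]
        exact htu v u huv.symm
      · rwa [hneg v hv]
  have hcard' : 3 ≤ ncolors d' := by
    have hsub : (Finset.univ.image d).erase i ⊆ Finset.univ.image d' := by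
      intro x hx
      obtain ⟨hxi, hx⟩ := Finset.mem_erase.mp hx
      obtain ⟨v, -, rfl⟩ := Finset.mem_image.mp hx
      exact Finset.mem_image.mpr ⟨v, Finset.mem_univ v, hneg v hxi⟩
    have := Finset.card_le_card hsub
    rw [Finset.card_erase_of_mem hi] at this
    unfold ncolors at hcard ⊢
    omega
  have hd'range : ∀ v, ∃ w, d w = d' v := by
    intro v
    by_cases hv : d v = i
    · rw [hpos v hv]
      exact htrange v
    · exact ⟨v, (hneg v hv).symm⟩
  refine hc.2 (Sum.elim d' (c ∘ Sum.inr)) ⟨hc.1, isAcyclicColoring_join ?_ ?_ ?_, i, ?_, ?_, ?_⟩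
  · exact hacyc d' hproper hcard'
  · exact hinj
  · intro a b
    obtain ⟨x, hx⟩ := hd'range a
    exact fun h => hd x b (hx.trans h)
  · exact ⟨Sum.inl w, hw⟩
  · rintro (v | v) hv
    · exact hneg v hv
    · rfl
  · rintro (v | v) hv
    · obtain ⟨x, hx⟩ := htrange v
      have hv' : d v = i := hv
      simp only [Sum.elim_inl, hpos v hv']
      refine ⟨⟨Sum.inl x, hx⟩, hv' ▸ htv v, ?_⟩
      rintro u (rfl | hu)
      · exact (htv v).symm
      · rcases u with u | u
        · exact htu v u hu
        · exact hx ▸ (hd x u).symm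
    · exact absurd (hw.trans hv.symm) (hd w v)

lemma ncolors_le_add [Fintype β] (c : α ⊕ β → ℕ) :
    ncolors c ≤ ncolors (c ∘ Sum.inl) + ncolors (c ∘ Sum.inr) := by
  have hsub : Finset.univ.image c ⊆
      Finset.univ.image (c ∘ Sum.inl) ∪ Finset.univ.image (c ∘ Sum.inr) := by
    intro x hx
    simpa using hx
  exact (Finset.card_le_card hsub).trans (Finset.card_union_le _ _)

/-- A coloring of `G` with the colors `0, 1, 2`, each having a b-vertex, extends to a minimal
coloring of `G ∨ H` that is injective on `H`, unless it is injective on `G`. -/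
lemma exists_isMinimal_join [Fintype β] {d : α → ℕ} (hd : IsAcyclicColoring G d) (hlt : ∀ v, d v < 3)
    (hb : ∀ i < 3, ∃ v, d v = i ∧ ∀ j < 3, j ≠ i → ∃ u, G.Adj v u ∧ d u = j)
    (hinj : ¬ Function.Injective d) :
    ∃ c, IsMinimal (join G H) c ∧ ncolors c = 3 + Fintype.card β := by
  let e := Fintype.equivFin β
  let c : α ⊕ β → ℕ := Sum.elim d fun b => 3 + (e b : ℕ)
  have hcinj : Function.Injective (c ∘ Sum.inr) := fun x y hxy => by
    have : 3 + (e x : ℕ) = 3 + (e y : ℕ) := hxy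
    exact e.injective (Fin.ext (by omega))
  have hne : ∀ a b, c (Sum.inl a) ≠ c (Sum.inr b) := fun a b => by
    have := hlt a
    change d a ≠ 3 + (e b : ℕ)
    omega
  have hc : IsAcyclicColoring (join G H) c := isAcyclicColoring_join hd hcinj hne
  refine ⟨c, ⟨hc, ?_⟩, ?_⟩
  · rintro c' ⟨-, hc', i, ⟨w, rfl⟩, hkeep, hmove⟩
    rcases w with w | w
    · obtain ⟨v, hv, hnbr⟩ := hb (d w) (hlt w)
      obtain ⟨⟨x, hx⟩, hxi, hfree⟩ := hmove (Sum.inl v) hv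
      rcases x with x | x
      · obtain ⟨u, hu, hux⟩ := hnbr (d x) (hlt x) (fun h => hxi (hx.symm.trans h))
        exact hfree (Sum.inl u) (Or.inr hu) (hux.trans hx)
      · exact hfree (Sum.inr x) (Or.inr trivial) hx
    · obtain ⟨⟨x, hx⟩, hxi, hfree⟩ := hmove (Sum.inr w) rfl
      rcases x with x | x
      · exact hfree (Sum.inl x) (Or.inr trivial) hx
      · rcases hc'.injective_or_injective with h | h
        · exact hinj fun a b hab =>
            h (((hkeep _ (hne a w)).trans hab).trans (hkeep _ (hne b w)).symm)
        · have hxw : c (Sum.inr x) ≠ c (Sum.inr w) := fun h => hxi (hx.symm.trans h)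
          have : x = w := h ((hkeep _ hxw).trans hx)
          exact hxw (by rw [this])
  · have himage : Finset.univ.image c = Finset.range (3 + Fintype.card β) := by
      ext m
      simp only [Finset.mem_image, Finset.mem_univ, true_and, Finset.mem_range]
      constructor
      · rintro ⟨a | b, rfl⟩
        · have : c (Sum.inl a) < 3 := hlt a
          omega
        · have : c (Sum.inr b) = 3 + (e b : ℕ) := rfl
          have := (e b).isLt
          omega
      · intro hm
        by_cases h3 : m < 3
        · obtain ⟨v, hv, -⟩ := hb m h3
          exact ⟨Sum.inl v, hv⟩
        · refine ⟨Sum.inr (e.symm ⟨m - 3, by omega⟩), ?_⟩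
          simp only [c, Sum.elim_inr, Equiv.apply_symm_apply]
          omega
    rw [ncolors, himage, Finset.card_range]

end Minimal

/-! ### Graphs between a path and a cycle -/

section PathCycle

variable {n : ℕ} {G : SimpleGraph (Fin n)}

lemma cycleGraph_adj_cases {u v : Fin n} (h : (cycleGraph n).Adj u v) :
    u.val + 1 = v.val ∨ v.val + 1 = u.val ∨
      (u.val = 0 ∧ v.val + 1 = n) ∨ (v.val = 0 ∧ u.val + 1 = n) := by
  rw [cycleGraph_adj'] at h
  have hu := u.isLt
  have hv := v.isLt
  rcases le_total u v with huv | huv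
  · have h1 := Fin.sub_val_of_le huv
    rcases huv.eq_or_lt with rfl | hlt
    · omega
    · have h2 := Fin.coe_sub_iff_lt.mpr hlt
      have := Fin.lt_def.mp hlt
      omega
  · have h1 := Fin.sub_val_of_le huv
    rcases huv.eq_or_lt with rfl | hlt
    · omega
    · have h2 := Fin.coe_sub_iff_lt.mpr hlt
      have := Fin.lt_def.mp hlt
      omega

lemma eq_of_adj_of_le_cycleGraph (hG : G ≤ cycleGraph n) (hn : 3 ≤ n) (v x y z : Fin n)
    (hx : G.Adj v x) (hy : G.Adj v y) (hz : G.Adj v z) : x = y ∨ x = z ∨ y = z := by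
  have hx := cycleGraph_adj_cases (hG hx)
  have hy := cycleGraph_adj_cases (hG hy)
  have hz := cycleGraph_adj_cases (hG hz)
  simp only [Fin.ext_iff]
  omega

lemma isAcyclicColoring_of_le_cycleGraph (hG : G ≤ cycleGraph n) (hn : 3 ≤ n) (c : Fin n → ℕ)
    (hc : Proper G c) (hcard : 3 ≤ ncolors c) : IsAcyclicColoring G c := by
  refine ⟨hc, fun i j => ?_⟩
  obtain ⟨w, hw⟩ : ∃ w, ¬ (c w = i ∨ c w = j) := by
    by_contra! hcon
    have hsub : Finset.univ.image c ⊆ {i, j} := by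
      intro x hx
      obtain ⟨v, -, rfl⟩ := Finset.mem_image.mp hx
      simpa using hcon v
    have := (Finset.card_le_card hsub).trans Finset.card_le_two
    unfold ncolors at hcard
    omega
  refine isAcyclic_of_rank
    (fun v => if w.val ≤ v.1.val then v.1.val - w.val else v.1.val + n - w.val) ?_
  rintro ⟨v, hv⟩ ⟨a, ha⟩ ⟨b, hb⟩ hva hvb hfa hfb
  have hva := cycleGraph_adj_cases (u := v) (v := a) (hG hva)
  have hvb := cycleGraph_adj_cases (u := v) (v := b) (hG hvb)
  have hvw : v.val ≠ w.val := fun h => hw (Fin.ext h ▸ hv)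
  have haw : a.val ≠ w.val := fun h => hw (Fin.ext h ▸ ha)
  have hbw : b.val ≠ w.val := fun h => hw (Fin.ext h ▸ hb)
  have := a.isLt
  have := b.isLt
  have := w.isLt
  refine Subtype.ext (Fin.ext ?_)
  dsimp only at hfa hfb ⊢
  split_ifs at hfa hfb <;> omega

/-- The coloring `0, 1, 2, 0, 1, 2, …` of the vertices of a path or cycle, where the last vertex
is recolored if it would get color `0`. -/
def cyclicColoring (n : ℕ) (v : Fin n) : ℕ :=
  if v.val + 1 = n ∧ n % 3 = 1 then 1 else v.val % 3

lemma cyclicColoring_lt (v : Fin n) : cyclicColoring n v < 3 := by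
  unfold cyclicColoring
  split_ifs <;> omega

lemma proper_cyclicColoring (hG : G ≤ cycleGraph n) (hn : 5 ≤ n) :
    Proper G (cyclicColoring n) := by
  intro u v huv
  have := cycleGraph_adj_cases (hG huv)
  have := u.isLt
  have := v.isLt
  unfold cyclicColoring
  split_ifs <;> omega

lemma cyclicColoring_of_lt {m : ℕ} (hn : 5 ≤ n) (hm : m < 5) :
    cyclicColoring n ⟨m, hm.trans_le hn⟩ = m % 3 := by
  unfold cyclicColoring
  dsimp only
  split_ifs <;> omega

lemma not_injective_cyclicColoring (hn : 5 ≤ n) : ¬ Function.Injective (cyclicColoring n) := by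
  intro h
  have := @h ⟨0, by omega⟩ ⟨3, by omega⟩
    (by rw [cyclicColoring_of_lt hn (by omega), cyclicColoring_of_lt hn (by omega)])
  simp at this

lemma exists_bVertex_cyclicColoring (hG : pathGraph n ≤ G) (hn : 5 ≤ n) (i : ℕ) (hi : i < 3) :
    ∃ v, cyclicColoring n v = i ∧
      ∀ j < 3, j ≠ i → ∃ u, G.Adj v u ∧ cyclicColoring n u = j := by
  obtain ⟨m, hm, hm1, hm4⟩ : ∃ m, m % 3 = i ∧ 1 ≤ m ∧ m < 4 := by
    by_cases h : i = 0
    · exact ⟨3, by omega⟩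
    · exact ⟨i, by omega⟩
  refine ⟨⟨m, by omega⟩, by rw [cyclicColoring_of_lt hn (by omega), hm], fun j hj hji => ?_⟩
  by_cases h : (m + 1) % 3 = j
  · refine ⟨⟨m + 1, by omega⟩, hG ?_, by rw [cyclicColoring_of_lt hn (by omega), h]⟩
    simp [pathGraph_adj]
  · refine ⟨⟨m - 1, by omega⟩, hG ?_, by rw [cyclicColoring_of_lt hn (by omega)]; omega⟩
    simp only [pathGraph_adj]
    omega

lemma isAcyclicColoring_cyclicColoring (hP : pathGraph n ≤ G) (hC : G ≤ cycleGraph n)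
    (hn : 5 ≤ n) : IsAcyclicColoring G (cyclicColoring n) := by
  refine isAcyclicColoring_of_le_cycleGraph hC (by omega) _ (proper_cyclicColoring hC hn) ?_
  have hsub : Finset.range 3 ⊆ Finset.univ.image (cyclicColoring n) := fun i hi => by
    obtain ⟨v, hv, -⟩ := exists_bVertex_cyclicColoring hP hn i (Finset.mem_range.mp hi)
    exact Finset.mem_image.mpr ⟨v, Finset.mem_univ v, hv⟩
  simpa [ncolors] using Finset.card_le_card hsub

lemma ab_join_of_le_cycleGraph {k ℓ : ℕ} {G : SimpleGraph (Fin k)} {H : SimpleGraph (Fin ℓ)}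
    (hk : 5 ≤ k) (hℓ : 5 ≤ ℓ) (hPG : pathGraph k ≤ G) (hGC : G ≤ cycleGraph k)
    (hPH : pathGraph ℓ ≤ H) (hHC : H ≤ cycleGraph ℓ) :
    Ab (join G H) = 3 + max k ℓ := by
  have upper : ∀ {p q : ℕ} {A : SimpleGraph (Fin p)} {B : SimpleGraph (Fin q)}, 5 ≤ p →
      A ≤ cycleGraph p → ∀ {c}, IsMinimal (join A B) c →
      Function.Injective (c ∘ Sum.inr) → ncolors c ≤ 3 + q := by
    intro p q A B hp hA c hc hinj
    have h1 := hc.ncolors_inl_le hinj (eq_of_adj_of_le_cycleGraph hA (by omega))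
      (isAcyclicColoring_of_le_cycleGraph hA (by omega))
    have h2 : ncolors (c ∘ Sum.inr) ≤ q := by
      simpa [ncolors] using Finset.card_image_le (s := Finset.univ) (f := c ∘ Sum.inr)
    have := ncolors_le_add c
    omega
  have lower : ∀ {p q : ℕ} {A : SimpleGraph (Fin p)} {B : SimpleGraph (Fin q)}, 5 ≤ p →
      pathGraph p ≤ A → A ≤ cycleGraph p →
      ∃ c, IsMinimal (join A B) c ∧ ncolors c = 3 + q := by
    intro p q A B hp hPA hAC
    simpa using exists_isMinimal_join (H := B) (isAcyclicColoring_cyclicColoring hPA hAC hp)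
      cyclicColoring_lt (exists_bVertex_cyclicColoring hPA hp) (not_injective_cyclicColoring hp)
  refine IsGreatest.csSup_eq ⟨?_, ?_⟩
  · rcases le_total k ℓ with h | h
    · rw [max_eq_right h]
      exact lower hk hPG hGC
    · rw [max_eq_left h]
      obtain ⟨c, hc, hn⟩ := lower (B := G) hℓ hPH hHC
      exact ⟨_, hc.comp_iso (joinComm G H), (ncolors_comp_iso c (joinComm G H)).trans hn⟩
  · rintro _ ⟨c, hc, rfl⟩
    rcases hc.1.injective_or_injective with h | h
    · have hle := upper hℓ hHC (hc.comp_iso (joinComm H G)) h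
      rw [ncolors_comp_iso] at hle
      exact hle.trans (by omega)
    · exact (upper hk hGC hc h).trans (by omega)

end PathCycle

/-- For all `k, ℓ ≥ 5`,
`A_b(P_k ∨ P_ℓ) = A_b(P_k ∨ C_ℓ) = A_b(C_k ∨ C_ℓ) = 3 + max {k, ℓ}`. -/
theorem ab_join_paths_cycles (k ℓ : ℕ) (hk : 5 ≤ k) (hℓ : 5 ≤ ℓ) :
    Ab (join (pathGraph k) (pathGraph ℓ)) = 3 + max k ℓ ∧
    Ab (join (pathGraph k) (cycleGraph ℓ)) = 3 + max k ℓ ∧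
    Ab (join (cycleGraph k) (cycleGraph ℓ)) = 3 + max k ℓ := by
  have path_le {n : ℕ} : pathGraph n ≤ cycleGraph n := pathGraph_le_cycleGraph
  exact ⟨ab_join_of_le_cycleGraph hk hℓ le_rfl path_le le_rfl path_le,
    ab_join_of_le_cycleGraph hk hℓ le_rfl path_le path_le le_rfl,
    ab_join_of_le_cycleGraph hk hℓ path_le le_rfl path_le le_rfl⟩

end AcyclicB
end
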